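/- arXiv:0801.0458 — 3 statements merged into one kernel-verified Lean document; each statement's English description precedes it below -/
import Mathlib

section
/- For any tripartite quantum state ρ_{ABC} on a finite-dimensional Hilbert space, the quantum conditional mutual information I(A:B|C) := S(AC) + S(BC) - S(ABC) - S(C) is nonnegative, where S denotes the von Neumann entropy of the corresponding reduced state. -/
open scoped BigOperators ComplexOrder

noncomputable section

namespace QP

/-- Von Neumann entropy of a (Hermitian) matrix, via its eigenvalues. -/
noncomputable def entropy {n : Type*} [Fintype n] [DecidableEq n] (ρ : Matrix n n ℂ) : ℝ :=
  if h : ρ.IsHermitian then -∑ i, (h.eigenvalues i) * Real.log (h.eigenvalues i) else 0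

/-- A density operator: positive semidefinite with unit trace. -/
def IsState {n : Type*} [Fintype n] (ρ : Matrix n n ℂ) : Prop :=
  ρ.PosSemidef ∧ ρ.trace = 1

variable {A B C D : Type*} [Fintype A] [Fintype B] [Fintype C] [Fintype D]

/-- Partial trace over the second tensor factor. -/
def ptraceR (ρ : Matrix (A × B) (A × B) ℂ) : Matrix A A ℂ :=
  Matrix.of fun a a' => ∑ b, ρ (a, b) (a', b)

/-- Partial trace over the first tensor factor. -/
def ptraceL (ρ : Matrix (A × B) (A × B) ℂ) : Matrix B B ℂ :=
  Matrix.of fun b b' => ∑ a, ρ (a, b) (a, b')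

/-- Reduced state on `A × C` of a tripartite state on `A × B × C`. -/
def redAC (ρ : Matrix (A × B × C) (A × B × C) ℂ) : Matrix (A × C) (A × C) ℂ :=
  Matrix.of fun x y => ∑ b, ρ (x.1, b, x.2) (y.1, b, y.2)

/-- Reduced state on `B × C`. -/
def redBC (ρ : Matrix (A × B × C) (A × B × C) ℂ) : Matrix (B × C) (B × C) ℂ :=
  Matrix.of fun x y => ∑ a, ρ (a, x.1, x.2) (a, y.1, y.2)

/-- Reduced state on `A × B`. -/
def redAB (ρ : Matrix (A × B × C) (A × B × C) ℂ) : Matrix (A × B) (A × B) ℂ :=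
  Matrix.of fun x y => ∑ c, ρ (x.1, x.2, c) (y.1, y.2, c)

/-- Reduced state on `C`. -/
def redC (ρ : Matrix (A × B × C) (A × B × C) ℂ) : Matrix C C ℂ :=
  Matrix.of fun c c' => ∑ a, ∑ b, ρ (a, b, c) (a, b, c')

/-- Quantum conditional mutual information `I(A:B|C)`. -/
noncomputable def cmi [DecidableEq A] [DecidableEq B] [DecidableEq C]
    (ρ : Matrix (A × B × C) (A × B × C) ℂ) : ℝ :=
  entropy (redAC ρ) + entropy (redBC ρ) - entropy ρ - entropy (redC ρ)

/-- Quantum mutual information `I(A:B)`. -/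
noncomputable def mutInfo [DecidableEq A] [DecidableEq B]
    (ρ : Matrix (A × B) (A × B) ℂ) : ℝ :=
  entropy (ptraceR ρ) + entropy (ptraceL ρ) - entropy ρ

/-- Squashed entanglement: infimum of `I(A:B|E')/2` over finite-dimensional extensions. -/
noncomputable def Esq [DecidableEq A] [DecidableEq B] (ρ : Matrix (A × B) (A × B) ℂ) : ℝ :=
  sInf { x : ℝ | ∃ (n : ℕ) (σ : Matrix (A × B × Fin n) (A × B × Fin n) ℂ),
    IsState σ ∧ redAB σ = ρ ∧ x = cmi σ / 2 }

/-- Puffed entanglement: supremum of `I(A:B|E')/2` over finite-dimensional extensions. -/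
noncomputable def Epu [DecidableEq A] [DecidableEq B] (ρ : Matrix (A × B) (A × B) ℂ) : ℝ :=
  sSup { x : ℝ | ∃ (n : ℕ) (σ : Matrix (A × B × Fin n) (A × B × Fin n) ℂ),
    IsState σ ∧ redAB σ = ρ ∧ x = cmi σ / 2 }

/-- Rank-one projector `|ψ⟩⟨ψ|`. -/
def outer {n : Type*} (ψ : n → ℂ) : Matrix n n ℂ :=
  Matrix.of fun x y => ψ x * star (ψ y)

/-- `ψ` is a unit vector. -/
def IsUnitVec {n : Type*} [Fintype n] (ψ : n → ℂ) : Prop :=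
  ∑ x, Complex.normSq (ψ x) = 1

/-- Four-partite reductions (system order `A × B × D × C`, with `D` playing `A'`). -/
def r4AC (ρ : Matrix (A × B × D × C) (A × B × D × C) ℂ) : Matrix (A × C) (A × C) ℂ :=
  Matrix.of fun x y => ∑ b, ∑ d, ρ (x.1, b, d, x.2) (y.1, b, d, y.2)

def r4BC (ρ : Matrix (A × B × D × C) (A × B × D × C) ℂ) : Matrix (B × C) (B × C) ℂ :=
  Matrix.of fun x y => ∑ a, ∑ d, ρ (a, x.1, d, x.2) (a, y.1, d, y.2)

def r4ABC (ρ : Matrix (A × B × D × C) (A × B × D × C) ℂ) : Matrix (A × B × C) (A × B × C) ℂ :=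
  Matrix.of fun x y => ∑ d, ρ (x.1, x.2.1, d, x.2.2) (y.1, y.2.1, d, y.2.2)

def r4C (ρ : Matrix (A × B × D × C) (A × B × D × C) ℂ) : Matrix C C ℂ :=
  Matrix.of fun c c' => ∑ a, ∑ b, ∑ d, ρ (a, b, d, c) (a, b, d, c')

def r4A (ρ : Matrix (A × B × D × C) (A × B × D × C) ℂ) : Matrix A A ℂ :=
  Matrix.of fun a a' => ∑ b, ∑ d, ∑ c, ρ (a, b, d, c) (a', b, d, c)

def r4D (ρ : Matrix (A × B × D × C) (A × B × D × C) ℂ) : Matrix D D ℂ :=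
  Matrix.of fun d d' => ∑ a, ∑ b, ∑ c, ρ (a, b, d, c) (a, b, d', c)

def r4AD (ρ : Matrix (A × B × D × C) (A × B × D × C) ℂ) : Matrix (A × D) (A × D) ℂ :=
  Matrix.of fun x y => ∑ b, ∑ c, ρ (x.1, b, x.2, c) (y.1, b, y.2, c)

def r4DC (ρ : Matrix (A × B × D × C) (A × B × D × C) ℂ) : Matrix (D × C) (D × C) ℂ :=
  Matrix.of fun x y => ∑ a, ∑ b, ρ (a, b, x.1, x.2) (a, b, y.1, y.2)

/-- `I(A:B|C)` for a four-partite state on `A × B × D × C`, conditioning on the last factor. -/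
noncomputable def cmi4 [DecidableEq A] [DecidableEq B] [DecidableEq C] [DecidableEq D]
    (ρ : Matrix (A × B × D × C) (A × B × D × C) ℂ) : ℝ :=
  entropy (r4AC ρ) + entropy (r4BC ρ) - entropy (r4ABC ρ) - entropy (r4C ρ)

end QP

open QP
namespace QP

section

open Filter Topology Matrix
open scoped Kronecker

section LogSums

variable {ι κ : Type*} [Fintype ι] [Fintype κ]

/-- A resolvent-type regularisation of `∑ w p log q`, interpolating in `t` between
`∑ w p log q` at `t = 0` and, up to the divergent part, `∑ w p log p` at `t = ∞`. -/
def logSum (w : κ → ι → ℝ) (p : ι → ℝ) (q : κ → ℝ) (t : ℝ) : ℝ :=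
  ∑ k, ∑ i, w k i * (p i * Real.log (q k + t * p i))

/-- The derivative of `logSum` in its parameter. -/
def logSumDeriv (w : κ → ι → ℝ) (p : ι → ℝ) (q : κ → ℝ) (t : ℝ) : ℝ :=
  ∑ k, ∑ i, w k i * (p i ^ 2 / (q k + t * p i))

variable {w : κ → ι → ℝ} {p : ι → ℝ} {q : κ → ℝ}

lemma hasDerivAt_logSum (hp : ∀ i, 0 ≤ p i) (hq : ∀ k, 0 ≤ q k) {t : ℝ} (ht : 0 < t) :
    HasDerivAt (logSum w p q) (logSumDeriv w p q t) t := by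
  refine HasDerivAt.fun_sum fun k _ => HasDerivAt.fun_sum fun i _ => HasDerivAt.const_mul _ ?_
  rcases (hp i).eq_or_lt with h | h
  · simp [← h, hasDerivAt_const]
  · have hpos : 0 < q k + t * p i := by have := hq k; positivity
    have h1 : HasDerivAt (fun t => q k + t * p i) (p i) t := by
      simpa using ((hasDerivAt_id t).mul_const (p i)).const_add (q k)
    convert (h1.log hpos.ne').const_mul (p i) using 1
    ring

lemma tendsto_logSum_zero (h0 : ∀ k i, q k = 0 → w k i * p i = 0) :
    Tendsto (logSum w p q) (𝓝[>] 0) (𝓝 (∑ k, ∑ i, w k i * (p i * Real.log (q k)))) := by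
  refine tendsto_finsetSum _ fun k _ => tendsto_finsetSum _ fun i _ => ?_
  simp_rw [← mul_assoc]
  by_cases hk : q k = 0
  · simp [h0 k i hk]
  · have h1 : Tendsto (fun t => q k + t * p i) (𝓝[>] 0) (𝓝 (q k)) := by
      have : ContinuousAt (fun t => q k + t * p i) 0 := by fun_prop
      simpa [ContinuousAt] using this.mono_left nhdsWithin_le_nhds
    exact (h1.log hk).const_mul _

lemma tendsto_logSum_atTop (hp : ∀ i, 0 ≤ p i) (hq : ∀ k, 0 ≤ q k) :
    Tendsto (fun t => logSum w p q t - (∑ k, ∑ i, w k i * p i) * Real.log t) atTop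
      (𝓝 (∑ k, ∑ i, w k i * (p i * Real.log (p i)))) := by
  simp_rw [logSum, Finset.sum_mul, ← Finset.sum_sub_distrib]
  refine tendsto_finsetSum _ fun k _ => tendsto_finsetSum _ fun i _ => ?_
  rcases (hp i).eq_or_lt with h | h
  · simp [← h]
  · have h1 : Tendsto (fun t : ℝ => q k / t + p i) atTop (𝓝 (p i)) := by
      simpa using (tendsto_const_nhds.div_atTop tendsto_id).add_const (p i)
    refine (((h1.log h.ne').const_mul (p i)).const_mul (w k i)).congr' ?_
    filter_upwards [eventually_gt_atTop 0] with t ht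
    have h2 : q k + t * p i = t * (q k / t + p i) := by field_simp
    have h3 : q k / t + p i ≠ 0 := by have := hq k; positivity
    rw [h2, Real.log_mul ht.ne' h3]
    ring

/-- If the derivatives of two `logSum`s are ordered and their total masses agree, then so are the
associated relative entropies. -/
lemma sum_log_sub_le_of_logSumDeriv_le {ι' κ' : Type*} [Fintype ι'] [Fintype κ']
    {w' : κ' → ι' → ℝ} {p' : ι' → ℝ} {q' : κ' → ℝ}
    (hp : ∀ i, 0 ≤ p i) (hq : ∀ k, 0 ≤ q k) (h0 : ∀ k i, q k = 0 → w k i * p i = 0)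
    (hp' : ∀ i, 0 ≤ p' i) (hq' : ∀ k, 0 ≤ q' k) (h0' : ∀ k i, q' k = 0 → w' k i * p' i = 0)
    (hmass : ∑ k, ∑ i, w' k i * p' i = ∑ k, ∑ i, w k i * p i)
    (hle : ∀ t, 0 < t → logSumDeriv w' p' q' t ≤ logSumDeriv w p q t) :
    ∑ k, ∑ i, w' k i * (p' i * Real.log (p' i)) - ∑ k, ∑ i, w' k i * (p' i * Real.log (q' k)) ≤
      ∑ k, ∑ i, w k i * (p i * Real.log (p i)) - ∑ k, ∑ i, w k i * (p i * Real.log (q k)) := by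
  set f := fun t => logSum w p q t - logSum w' p' q' t with hf
  have hder : ∀ t, 0 < t → HasDerivAt f (logSumDeriv w p q t - logSumDeriv w' p' q' t) t :=
    fun t ht => (hasDerivAt_logSum hp hq ht).sub (hasDerivAt_logSum hp' hq' ht)
  have hmono : MonotoneOn f (Set.Ioi 0) := by
    apply monotoneOn_of_deriv_nonneg (convex_Ioi 0)
    · exact fun t ht => (hder t ht).continuousAt.continuousWithinAt
    · rw [interior_Ioi]
      exact fun t ht => (hder t ht).differentiableAt.differentiableWithinAt
    · rw [interior_Ioi]
      intro t ht
      rw [(hder t ht).deriv]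
      exact sub_nonneg.2 (hle t ht)
  have hzero := (tendsto_logSum_zero h0).sub (tendsto_logSum_zero h0')
  have htop := (tendsto_logSum_atTop (w := w) hp hq).sub (tendsto_logSum_atTop (w := w') hp' hq')
  have htop' : Tendsto f atTop (𝓝 (∑ k, ∑ i, w k i * (p i * Real.log (p i)) -
      ∑ k, ∑ i, w' k i * (p' i * Real.log (p' i)))) := by
    refine htop.congr fun t => ?_
    rw [hmass, hf]
    ring
  have h1 : ∀ s, 0 < s → f s ≤ _ := fun s hs => ge_of_tendsto htop' <| by
    filter_upwards [eventually_ge_atTop s] with t ht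
    exact hmono hs (lt_of_lt_of_le hs ht) ht
  have h2 := le_of_tendsto hzero (eventually_nhdsWithin_of_forall h1)
  linarith

end LogSums

section Variational

variable {n : Type*} [Fintype n] [DecidableEq n]

/-- The quadratic functional whose supremum over `X` is the quasi-entropy
`⟨M, (L_N + t R_M)⁻¹ M⟩` in Hilbert-Schmidt space. -/
def quasiForm (M N X : Matrix n n ℂ) (t : ℝ) : ℝ :=
  2 * (Xᴴ * M).trace.re - (X * Xᴴ * N).trace.re - t * (Xᴴ * X * M).trace.re

lemma trace_conj {U : Matrix n n ℂ} (hU : Uᴴ * U = 1) (Z : Matrix n n ℂ) :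
    (U * Z * Uᴴ).trace = Z.trace := by
  rw [trace_mul_cycle, hU, Matrix.one_mul]

lemma quasiForm_conj {U V : Matrix n n ℂ} (hU : Uᴴ * U = 1) (hV : Vᴴ * V = 1)
    (p q : n → ℝ) (Y : Matrix n n ℂ) (t : ℝ) :
    quasiForm (U * diagonal (fun i => (p i : ℂ)) * Uᴴ) (V * diagonal (fun i => (q i : ℂ)) * Vᴴ)
      (V * Y * Uᴴ) t =
    ∑ k, ∑ i, (2 * (p i * (star (Y k i) * (Vᴴ * U) k i).re)
      - (q k + t * p i) * Complex.normSq (Y k i)) := by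
  have cancel {S : Matrix n n ℂ} (h : Sᴴ * S = 1) (Z : Matrix n n ℂ) : Sᴴ * (S * Z) = Z := by
    rw [← Matrix.mul_assoc, h, Matrix.one_mul]
  set P := diagonal (fun i => (p i : ℂ)) with hP
  set Q := diagonal (fun i => (q i : ℂ)) with hQ
  have e1 : ((V * Y * Uᴴ)ᴴ * (U * P * Uᴴ)).trace = (Yᴴ * (Vᴴ * U) * P).trace := by
    rw [← trace_conj hU (Yᴴ * (Vᴴ * U) * P)]
    simp only [conjTranspose_mul, conjTranspose_conjTranspose, Matrix.mul_assoc]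
  have e2 : ((V * Y * Uᴴ) * (V * Y * Uᴴ)ᴴ * (V * Q * Vᴴ)).trace = (Y * Yᴴ * Q).trace := by
    rw [← trace_conj hV (Y * Yᴴ * Q)]
    simp only [conjTranspose_mul, conjTranspose_conjTranspose, Matrix.mul_assoc, cancel hU,
      cancel hV]
  have e3 : ((V * Y * Uᴴ)ᴴ * (V * Y * Uᴴ) * (U * P * Uᴴ)).trace = (Yᴴ * Y * P).trace := by
    rw [← trace_conj hU (Yᴴ * Y * P)]
    simp only [conjTranspose_mul, conjTranspose_conjTranspose, Matrix.mul_assoc, cancel hU,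
      cancel hV]
  rw [quasiForm, e1, e2, e3, hP, hQ]
  generalize Vᴴ * U = W
  have f1 : (Yᴴ * W * diagonal (fun i => (p i : ℂ))).trace.re =
      ∑ k, ∑ i, p i * (star (Y k i) * W k i).re := by
    rw [Finset.sum_comm]
    simp only [trace, diag_apply, mul_diagonal, Complex.re_sum, Complex.re_mul_ofReal]
    simp only [mul_apply, conjTranspose_apply, Complex.re_sum, Finset.sum_mul, mul_comm (p _)]
  have f2 : (Y * Yᴴ * diagonal (fun i => (q i : ℂ))).trace.re =
      ∑ k, ∑ i, q k * Complex.normSq (Y k i) := by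
    simp only [trace, diag_apply, mul_diagonal, Complex.re_sum, Complex.re_mul_ofReal]
    simp only [mul_apply, conjTranspose_apply, Complex.star_def, Complex.mul_conj, Complex.re_sum,
      Complex.ofReal_re, Finset.sum_mul, mul_comm (q _)]
  have f3 : (Yᴴ * Y * diagonal (fun i => (p i : ℂ))).trace.re =
      ∑ k, ∑ i, p i * Complex.normSq (Y k i) := by
    rw [Finset.sum_comm]
    simp only [trace, diag_apply, mul_diagonal, Complex.re_sum, Complex.re_mul_ofReal]
    simp only [mul_apply, conjTranspose_apply, Complex.star_def, ← Complex.normSq_eq_conj_mul_self,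
      Complex.re_sum, Complex.ofReal_re, Finset.sum_mul, mul_comm (p _)]
  rw [f1, f2, f3]
  simp only [Finset.mul_sum, ← Finset.sum_sub_distrib]
  refine Finset.sum_congr rfl fun k _ => Finset.sum_congr rfl fun i _ => ?_
  ring

lemma two_mul_sub_le_div (z w : ℂ) {p r : ℝ} (hr : 0 ≤ r) (hp : r = 0 → p = 0) :
    2 * (p * (star z * w).re) - r * Complex.normSq z ≤ Complex.normSq w * (p ^ 2 / r) := by
  rcases hr.eq_or_lt with h | h
  · simp [← h, hp h.symm]
  · rw [← mul_div_assoc, le_div_iff₀ h]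
    have := Complex.normSq_nonneg (r * z - p * w)
    simp only [Complex.normSq_apply, Complex.sub_re, Complex.sub_im, Complex.mul_re,
      Complex.mul_im, Complex.ofReal_re, Complex.ofReal_im, Complex.star_def, Complex.conj_re,
      Complex.conj_im] at this ⊢
    nlinarith

lemma two_mul_sub_eq_div (w : ℂ) {p r : ℝ} (hp : r = 0 → p = 0) :
    2 * (p * (star (((p / r : ℝ) : ℂ) * w) * w).re) -
      r * Complex.normSq (((p / r : ℝ) : ℂ) * w) = Complex.normSq w * (p ^ 2 / r) := by
  by_cases h : r = 0
  · simp [h, hp h]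
  · simp only [Complex.normSq_apply, Complex.mul_re, Complex.mul_im, Complex.ofReal_re,
      Complex.ofReal_im, Complex.star_def, Complex.conj_re, Complex.conj_im]
    field_simp
    ring

lemma add_mul_eq_zero_imp {n : Type*} {p q : n → ℝ} {t : ℝ} (hp : ∀ i, 0 ≤ p i) (hq : ∀ k, 0 ≤ q k) (ht : 0 < t) (k i : n)
    (h : q k + t * p i = 0) : p i = 0 := by
  have h1 := mul_nonneg ht.le (hp i)
  have h2 : t * p i = 0 := by linarith [hq k]
  exact (mul_eq_zero.1 h2).resolve_left ht.ne'

variable {U V : Matrix n n ℂ} {p q : n → ℝ} {t : ℝ}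

lemma quasiForm_le_logSumDeriv (hU : U ∈ unitaryGroup n ℂ) (hV : V ∈ unitaryGroup n ℂ)
    (hp : ∀ i, 0 ≤ p i) (hq : ∀ k, 0 ≤ q k) (ht : 0 < t) (X : Matrix n n ℂ) :
    quasiForm (U * diagonal (fun i => (p i : ℂ)) * Uᴴ) (V * diagonal (fun i => (q i : ℂ)) * Vᴴ)
      X t ≤ logSumDeriv (fun k i => Complex.normSq ((Vᴴ * U) k i)) p q t := by
  have hX : X = V * (Vᴴ * X * U) * Uᴴ := by
    have h1 : V * Vᴴ = 1 := mem_unitaryGroup_iff.1 hV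
    have h2 : U * Uᴴ = 1 := mem_unitaryGroup_iff.1 hU
    simp only [Matrix.mul_assoc, h2, Matrix.mul_one]
    rw [← Matrix.mul_assoc, h1, Matrix.one_mul]
  rw [hX, quasiForm_conj (mem_unitaryGroup_iff'.1 hU) (mem_unitaryGroup_iff'.1 hV)]
  refine Finset.sum_le_sum fun k _ => Finset.sum_le_sum fun i _ => ?_
  exact two_mul_sub_le_div _ _ (add_nonneg (hq k) (mul_nonneg ht.le (hp i)))
    (add_mul_eq_zero_imp hp hq ht k i)

lemma exists_quasiForm_eq_logSumDeriv (hU : U ∈ unitaryGroup n ℂ) (hV : V ∈ unitaryGroup n ℂ)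
    (hp : ∀ i, 0 ≤ p i) (hq : ∀ k, 0 ≤ q k) (ht : 0 < t) : ∃ X : Matrix n n ℂ,
    quasiForm (U * diagonal (fun i => (p i : ℂ)) * Uᴴ) (V * diagonal (fun i => (q i : ℂ)) * Vᴴ)
      X t = logSumDeriv (fun k i => Complex.normSq ((Vᴴ * U) k i)) p q t := by
  refine ⟨V * (Matrix.of fun k i => ((p i / (q k + t * p i) : ℝ) : ℂ) * (Vᴴ * U) k i) * Uᴴ, ?_⟩
  rw [quasiForm_conj (mem_unitaryGroup_iff'.1 hU) (mem_unitaryGroup_iff'.1 hV)]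
  refine Finset.sum_congr rfl fun k _ => Finset.sum_congr rfl fun i _ => ?_
  exact two_mul_sub_eq_div _ (add_mul_eq_zero_imp hp hq ht k i)

end Variational

section PartialTrace

variable {A B C D : Type*}

/-- The operator `X ⊗ 1_B` on `A ⊗ B ⊗ C`, for `X` acting on `A ⊗ C`. -/
def liftAC [DecidableEq B] (X : Matrix (A × C) (A × C) ℂ) : Matrix (A × B × C) (A × B × C) ℂ :=
  Matrix.of fun x y => if x.2.1 = y.2.1 then X (x.1, x.2.2) (y.1, y.2.2) else 0

lemma liftAC_mul [Fintype A] [Fintype B] [Fintype C] [DecidableEq B] (X Y : Matrix (A × C) (A × C) ℂ) :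
    (liftAC X * liftAC Y : Matrix (A × B × C) (A × B × C) ℂ) = liftAC (X * Y) := by
  ext ⟨a, b, c⟩ ⟨a', b', c'⟩
  simp only [liftAC, mul_apply, of_apply, Fintype.sum_prod_type, ite_mul, zero_mul, mul_ite,
    mul_zero]
  by_cases h : b = b'
  · subst h
    simp [Finset.sum_ite_irrel]
  · simp [h]

lemma liftAC_conjTranspose [DecidableEq B] (X : Matrix (A × C) (A × C) ℂ) :
    (liftAC X : Matrix (A × B × C) (A × B × C) ℂ)ᴴ = liftAC Xᴴ := by
  ext ⟨a, b, c⟩ ⟨a', b', c'⟩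
  by_cases h : b = b' <;> simp [liftAC, h, eq_comm]

lemma trace_liftAC_mul [Fintype A] [Fintype B] [Fintype C] [DecidableEq B] (X : Matrix (A × C) (A × C) ℂ) (M : Matrix (A × B × C) (A × B × C) ℂ) :
    (liftAC X * M).trace = (X * redAC M).trace := by
  simp only [trace, diag_apply, liftAC, redAC, mul_apply, of_apply, Fintype.sum_prod_type, ite_mul,
    zero_mul, Finset.mul_sum, Finset.sum_ite_eq, Finset.mem_univ, if_true,
    Finset.sum_comm (s := (Finset.univ : Finset B))]

lemma quasiForm_liftAC [Fintype A] [Fintype B] [Fintype C] [DecidableEq B] (M N : Matrix (A × B × C) (A × B × C) ℂ) (X : Matrix (A × C) (A × C) ℂ)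
    (t : ℝ) : quasiForm M N (liftAC X) t = quasiForm (redAC M) (redAC N) X t := by
  simp only [quasiForm, liftAC_conjTranspose, liftAC_mul, trace_liftAC_mul]

lemma redAC_one_kronecker [Fintype B] [DecidableEq A] (N : Matrix (B × C) (B × C) ℂ) :
    redAC ((1 : Matrix A A ℂ) ⊗ₖ N) = (1 : Matrix A A ℂ) ⊗ₖ ptraceL N := by
  ext ⟨a, c⟩ ⟨a', c'⟩
  simp [redAC, ptraceL, Finset.mul_sum]

lemma ptraceL_redAC [Fintype A] [Fintype B] (M : Matrix (A × B × C) (A × B × C) ℂ) :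
    ptraceL (redAC M) = redC M := rfl

lemma ptraceL_ptraceL [Fintype A] [Fintype B] (M : Matrix (A × B × C) (A × B × C) ℂ) :
    ptraceL (ptraceL M) = redC M := by
  ext c c'
  exact Finset.sum_comm

lemma ptraceL_eq_redBC [Fintype A] (M : Matrix (A × B × C) (A × B × C) ℂ) : ptraceL M = redBC M := rfl

lemma trace_redAC [Fintype A] [Fintype B] [Fintype C] (M : Matrix (A × B × C) (A × B × C) ℂ) : (redAC M).trace = M.trace := by
  simp only [trace, diag_apply, redAC, of_apply, Fintype.sum_prod_type]
  exact Finset.sum_congr rfl fun a _ => Finset.sum_comm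

lemma posSemidef_redAC [Fintype B] {M : Matrix (A × B × C) (A × B × C) ℂ} (hM : M.PosSemidef) :
    (redAC M).PosSemidef := by
  have : redAC M = ∑ b : B, M.submatrix (fun x : A × C => (x.1, b, x.2))
      (fun x : A × C => (x.1, b, x.2)) := by
    ext x y
    simp [redAC, Matrix.sum_apply]
  rw [this]
  exact posSemidef_sum _ fun b _ => hM.submatrix _

lemma posSemidef_ptraceL [Fintype A] {M : Matrix (A × D) (A × D) ℂ} (hM : M.PosSemidef) :
    (ptraceL M).PosSemidef := by
  have : ptraceL M = ∑ a : A, M.submatrix (Prod.mk a) (Prod.mk a) := by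
    ext x y
    simp [ptraceL, Matrix.sum_apply]
  rw [this]
  exact posSemidef_sum _ fun b _ => hM.submatrix _

lemma ptraceL_conj_one_kronecker [Fintype A] [Fintype D] [DecidableEq A]
    (M : Matrix (A × D) (A × D) ℂ) (V : Matrix D D ℂ) :
    ptraceL (((1 : Matrix A A ℂ) ⊗ₖ V)ᴴ * M * ((1 : Matrix A A ℂ) ⊗ₖ V)) =
      Vᴴ * ptraceL M * V := by
  have h : ptraceL M = ∑ a : A, M.submatrix (Prod.mk a) (Prod.mk a) := by
    ext x y
    simp [ptraceL, Matrix.sum_apply]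
  rw [h, Matrix.mul_sum, Matrix.sum_mul]
  ext j j'
  simp only [ptraceL, of_apply, Matrix.sum_apply]
  refine Finset.sum_congr rfl fun a _ => ?_
  simp [mul_apply, Fintype.sum_prod_type, one_apply, Finset.sum_ite_irrel, apply_ite]

end PartialTrace

section Entropy

variable {A D : Type*} [Fintype A] [Fintype D] [DecidableEq A] [DecidableEq D]

lemma entropy_eq {n : Type*} [Fintype n] [DecidableEq n] {M : Matrix n n ℂ}
    (hM : M.IsHermitian) :
    entropy M = -∑ i, hM.eigenvalues i * Real.log (hM.eigenvalues i) := by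
  rw [entropy, dif_pos hM]

lemma spectral_decomposition {n : Type*} [Fintype n] [DecidableEq n] {M : Matrix n n ℂ}
    (hM : M.IsHermitian) :
    M = hM.eigenvectorUnitary * diagonal (fun i => (hM.eigenvalues i : ℂ)) *
      (hM.eigenvectorUnitary : Matrix n n ℂ)ᴴ :=
  hM.spectral_theorem

lemma conj_diagonal_apply_self {n : Type*} [Fintype n] [DecidableEq n] (W : Matrix n n ℂ)
    (p : n → ℝ) (k : n) :
    (W * diagonal (fun i => (p i : ℂ)) * Wᴴ) k k =
      ((∑ i, Complex.normSq (W k i) * p i : ℝ) : ℂ) := by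
  rw [mul_apply]
  simp only [mul_diagonal, conjTranspose_apply, Complex.ofReal_sum, Complex.ofReal_mul,
    Complex.star_def, ← Complex.mul_conj]
  exact Finset.sum_congr rfl fun i _ => by ring

lemma sum_normSq_unitary {n : Type*} [Fintype n] [DecidableEq n] {W : Matrix n n ℂ}
    (hW : W ∈ unitaryGroup n ℂ) (i : n) : ∑ k, Complex.normSq (W k i) = 1 := by
  have h : (Wᴴ * W) i i = 1 := by
    rw [show Wᴴ * W = 1 from mem_unitaryGroup_iff'.1 hW, one_apply_eq]
  simp only [mul_apply, conjTranspose_apply, Complex.star_def,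
    ← Complex.normSq_eq_conj_mul_self] at h
  exact_mod_cast h

/-- Spectral data computing the conditional entropy of `M`, together with the variational
characterisation of the associated `logSumDeriv`. -/
lemma exists_logSum_data {M : Matrix (A × D) (A × D) ℂ} (hM : M.PosSemidef) :
    ∃ (w : A × D → A × D → ℝ) (p q : A × D → ℝ),
      (∀ i, 0 ≤ p i) ∧ (∀ k, 0 ≤ q k) ∧ (∀ k i, q k = 0 → w k i * p i = 0) ∧
      ∑ k, ∑ i, w k i * p i = M.trace.re ∧
      ∑ k, ∑ i, w k i * (p i * Real.log (p i)) = -entropy M ∧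
      ∑ k, ∑ i, w k i * (p i * Real.log (q k)) = -entropy (ptraceL M) ∧
      ∀ t, 0 < t →
        (∀ X, quasiForm M ((1 : Matrix A A ℂ) ⊗ₖ ptraceL M) X t ≤ logSumDeriv w p q t) ∧
        ∃ X, quasiForm M ((1 : Matrix A A ℂ) ⊗ₖ ptraceL M) X t = logSumDeriv w p q t := by
  have hN := posSemidef_ptraceL hM
  set U : Matrix (A × D) (A × D) ℂ := (hM.1.eigenvectorUnitary).val
  set V₀ : Matrix D D ℂ := (hN.1.eigenvectorUnitary).val
  set p := hM.1.eigenvalues with hpdef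
  set q₀ := hN.1.eigenvalues
  have hU : U ∈ unitaryGroup (A × D) ℂ := hM.1.eigenvectorUnitary.2
  have hV₀ : V₀ ∈ unitaryGroup D ℂ := hN.1.eigenvectorUnitary.2
  set V : Matrix (A × D) (A × D) ℂ := (1 : Matrix A A ℂ) ⊗ₖ V₀ with hVdef
  have hV : V ∈ unitaryGroup (A × D) ℂ := by
    rw [mem_unitaryGroup_iff, star_eq_conjTranspose, hVdef, conjTranspose_kronecker,
      ← mul_kronecker_mul, conjTranspose_one, Matrix.one_mul,
      show V₀ * V₀ᴴ = 1 from mem_unitaryGroup_iff.1 hV₀, one_kronecker_one]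
  set q : A × D → ℝ := fun k => q₀ k.2 with hqdef
  have hMU : M = U * diagonal (fun i => (p i : ℂ)) * Uᴴ := spectral_decomposition hM.1
  have hNV₀ : ptraceL M = V₀ * diagonal (fun i => (q₀ i : ℂ)) * V₀ᴴ := spectral_decomposition hN.1
  have hNV : (1 : Matrix A A ℂ) ⊗ₖ ptraceL M = V * diagonal (fun i => (q i : ℂ)) * Vᴴ := by
    have : diagonal (fun i => (q i : ℂ)) =
        (1 : Matrix A A ℂ) ⊗ₖ diagonal (fun i => (q₀ i : ℂ)) := by
      rw [← diagonal_one, diagonal_kronecker_diagonal]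
      simp [hqdef]
    rw [this, hVdef, conjTranspose_kronecker, ← mul_kronecker_mul, ← mul_kronecker_mul, hNV₀]
    simp
  have hW : Vᴴ * U ∈ unitaryGroup (A × D) ℂ := mul_mem (Unitary.star_mem hV) hU
  have hp : ∀ i, 0 ≤ p i := hM.eigenvalues_nonneg
  have hq₀ : ∀ j, 0 ≤ q₀ j := hN.eigenvalues_nonneg
  have hcol : ∀ f : A × D → ℝ, ∑ k, ∑ i, Complex.normSq ((Vᴴ * U) k i) * f i = ∑ i, f i := by
    intro f
    rw [Finset.sum_comm]
    simp [← Finset.sum_mul, sum_normSq_unitary hW]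
  have hrow : ∀ j, ∑ a, ∑ i, Complex.normSq ((Vᴴ * U) (a, j) i) * p i = q₀ j := by
    intro j
    have h1 := congrFun (congrFun (ptraceL_conj_one_kronecker M V₀) j) j
    have h2 : V₀ᴴ * ptraceL M * V₀ = diagonal (fun i => (q₀ i : ℂ)) := by
      have h3 : V₀ᴴ * V₀ = 1 := mem_unitaryGroup_iff'.1 hV₀
      rw [hNV₀]
      simp only [Matrix.mul_assoc, h3, Matrix.mul_one]
      rw [← Matrix.mul_assoc, h3, Matrix.one_mul]
    have h4 : Vᴴ * M * V = (Vᴴ * U) * diagonal (fun i => (p i : ℂ)) * (Vᴴ * U)ᴴ := by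
      simp only [hMU, conjTranspose_mul, conjTranspose_conjTranspose, Matrix.mul_assoc]
    rw [h2, diagonal_apply_eq, ← hVdef, h4] at h1
    simp only [ptraceL, of_apply, conj_diagonal_apply_self] at h1
    exact_mod_cast h1
  refine ⟨fun k i => Complex.normSq ((Vᴴ * U) k i), p, q, hp, fun k => hq₀ k.2, ?_, ?_, ?_, ?_, ?_⟩
  · rintro ⟨a, j⟩ i hk
    have hnn : ∀ a i, 0 ≤ Complex.normSq ((Vᴴ * U) (a, j) i) * p i :=
      fun a i => mul_nonneg (Complex.normSq_nonneg _) (hp i)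
    have h1 := (hrow j).trans hk
    rw [Finset.sum_eq_zero_iff_of_nonneg fun a _ => Finset.sum_nonneg fun i _ => hnn a i] at h1
    have h2 := h1 a (Finset.mem_univ a)
    rw [Finset.sum_eq_zero_iff_of_nonneg fun i _ => hnn a i] at h2
    exact h2 i (Finset.mem_univ i)
  · rw [hcol, hM.1.trace_eq_sum_eigenvalues]
    simp [hpdef]
  · rw [hcol fun i => p i * Real.log (p i), entropy_eq hM.1, neg_neg]
  · rw [entropy_eq hN.1, neg_neg, Fintype.sum_prod_type_right]
    refine Finset.sum_congr rfl fun j _ => ?_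
    simp only [hqdef, ← mul_assoc, ← Finset.sum_mul, hrow]
    rfl
  · intro t ht
    rw [hNV]
    nth_rw 1 2 [hMU]
    exact ⟨quasiForm_le_logSumDeriv hU hV hp (fun k => hq₀ k.2) ht,
      exists_quasiForm_eq_logSumDeriv hU hV hp (fun k => hq₀ k.2) ht⟩

end Entropy

end

end QP

/-- strong subadditivity / nonnegativity of conditional mutual information. -/
theorem cmi_nonneg {A B C : Type*} [Fintype A] [Fintype B] [Fintype C]
    [DecidableEq A] [DecidableEq B] [DecidableEq C]
    (ρ : Matrix (A × B × C) (A × B × C) ℂ) (hρ : IsState ρ) :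
    0 ≤ cmi ρ := by
  obtain ⟨w, p, q, hp, hq, h0, hmass, hS, hSq, hvar⟩ := exists_logSum_data hρ.1
  obtain ⟨w', p', q', hp', hq', h0', hmass', hS', hSq', hvar'⟩ :=
    exists_logSum_data (posSemidef_redAC hρ.1)
  have key := sum_log_sub_le_of_logSumDeriv_le hp hq h0 hp' hq' h0'
    (by rw [hmass', hmass, trace_redAC]) fun t ht => by
      obtain ⟨X, hX⟩ := (hvar' t ht).2
      rw [← hX, ptraceL_redAC, ← ptraceL_ptraceL, ← redAC_one_kronecker, ← quasiForm_liftAC]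
      exact (hvar t ht).1 _
  rw [hS, hSq, hS', hSq', ptraceL_redAC, ptraceL_eq_redBC] at key
  rw [cmi]
  linarith
end
end

section
/- Let |ψ⟩_{ABA'C} = Σ_i √p_i |ψ^i⟩_{AB} |i⟩_{A'} |i⟩_C with {p_i} a probability distribution, the |ψ^i⟩_{AB} unit vectors, and {|i⟩} orthonormal. Then the conditional mutual information of the induced state satisfies (1/2) I(A:B|C) = Σ_i p_i S(ρ_A^i), where ρ_A^i = Tr_B |ψ^i⟩⟨ψ^i| — provided the states |ψ^i⟩ are mutually orthogonal. -/
open scoped BigOperators ComplexOrder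

noncomputable section

open QP

namespace QP

open Matrix Polynomial

lemma entropy_eq_sum_roots {n : Type*} [Fintype n] [DecidableEq n] {ρ : Matrix n n ℂ}
    (h : ρ.IsHermitian) :
    entropy ρ = (ρ.charpoly.roots.map fun z => Real.negMulLog z.re).sum := by
  rw [entropy, dif_pos h, h.roots_charpoly_eq_eigenvalues]
  simp [Real.negMulLog_eq_neg]

lemma entropy_eq_sum_of_charpoly_eq {n ι : Type*} [Fintype n] [DecidableEq n] [Fintype ι]
    {ρ : Matrix n n ℂ} (h : ρ.IsHermitian) (d : ι → ℝ)
    (hd : ρ.charpoly = ∏ i, (X - C (d i : ℂ))) :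
    entropy ρ = ∑ i, Real.negMulLog (d i) := by
  have hroots : ρ.charpoly.roots = Finset.univ.val.map fun i => (d i : ℂ) := by
    rw [hd]
    simpa using roots_multiset_prod_X_sub_C (Finset.univ.val.map fun i => (d i : ℂ))
  simp [entropy_eq_sum_roots h, hroots]

lemma entropy_diagonal {n : Type*} [Fintype n] [DecidableEq n] (d : n → ℝ) :
    entropy (diagonal fun i => (d i : ℂ)) = ∑ i, Real.negMulLog (d i) :=
  entropy_eq_sum_of_charpoly_eq
    (isHermitian_diagonal_iff.mpr fun i => by simp [isSelfAdjoint_iff]) d (charpoly_diagonal _)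

lemma entropy_transpose {n : Type*} [Fintype n] [DecidableEq n] {ρ : Matrix n n ℂ}
    (h : ρ.IsHermitian) : entropy ρᵀ = entropy ρ := by
  rw [entropy_eq_sum_roots h, entropy_eq_sum_roots h.transpose, charpoly_transpose]

/-- The two reductions of a pure state with coefficient matrix `M` have the same entropy. -/
lemma entropy_mul_conjTranspose_comm {m n : Type*} [Fintype m] [DecidableEq m]
    [Fintype n] [DecidableEq n] (M : Matrix m n ℂ) :
    entropy (M * Mᴴ) = entropy (Mᴴ * M) := by
  rw [entropy_eq_sum_roots (isHermitian_mul_conjTranspose_self M),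
    entropy_eq_sum_roots (isHermitian_conjTranspose_mul_self M)]
  have h := congrArg (fun q : ℂ[X] => (q.roots.map fun z => Real.negMulLog z.re).sum)
    (charpoly_mul_comm' M Mᴴ)
  simpa [roots_mul, (charpoly_monic _).ne_zero, Multiset.map_nsmul, Multiset.sum_nsmul] using h

lemma charpoly_blockDiagonal {n o : Type*} [Fintype n] [DecidableEq n] [Fintype o]
    [DecidableEq o] (M : o → Matrix n n ℂ) :
    (blockDiagonal M).charpoly = ∏ i, (M i).charpoly := by
  simp only [Matrix.charpoly, ← det_blockDiagonal]
  congr 1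
  ext ⟨a, i⟩ ⟨b, j⟩ : 2
  by_cases hij : i = j <;> by_cases hab : a = b <;>
    simp [blockDiagonal_apply, hij, hab]

lemma _root_.Matrix.IsHermitian.charpoly_smul {n : Type*} [Fintype n] [DecidableEq n]
    {ρ : Matrix n n ℂ} (h : ρ.IsHermitian) (c : ℝ) :
    ((c : ℂ) • ρ).charpoly = ∏ i, (X - C ((c * h.eigenvalues i : ℝ) : ℂ)) := by
  conv_lhs => rw [h.spectral_theorem, ← map_smul, Unitary.conjStarAlgAut_apply,
    charpoly_mul_comm, ← mul_assoc]
  simp [← diagonal_smul, charpoly_diagonal]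

/-- The joint entropy theorem for block diagonal states. -/
lemma entropy_blockDiagonal_smul {n o : Type*} [Fintype n] [DecidableEq n] [Fintype o]
    [DecidableEq o] (p : o → ℝ) (ρ : o → Matrix n n ℂ) (h : ∀ i, (ρ i).IsHermitian)
    (htr : ∀ i, (ρ i).trace = 1) :
    entropy (blockDiagonal fun i => (p i : ℂ) • ρ i) =
      ∑ i, Real.negMulLog (p i) + ∑ i, p i * entropy (ρ i) := by
  have hB : (blockDiagonal fun i => (p i : ℂ) • ρ i).IsHermitian := by
    rw [IsHermitian, blockDiagonal_conjTranspose]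
    simp [conjTranspose_smul, (h _).eq]
  rw [entropy_eq_sum_of_charpoly_eq hB (fun x : o × n => p x.1 * (h x.1).eigenvalues x.2)
    (by rw [charpoly_blockDiagonal, Fintype.prod_prod_type]
        exact Finset.prod_congr rfl fun i _ => (h i).charpoly_smul (p i)),
    Fintype.sum_prod_type, ← Finset.sum_add_distrib]
  refine Finset.sum_congr rfl fun i _ => ?_
  have hsum : ∑ k, (h i).eigenvalues k = 1 := by
    have := (h i).trace_eq_sum_eigenvalues
    rw [htr i] at this
    rw [← Complex.ofReal_inj, Complex.ofReal_sum, Complex.ofReal_one]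
    exact this.symm
  rw [entropy_eq_sum_of_charpoly_eq (h i) (h i).eigenvalues (h i).charpoly_eq]
  simp only [Real.negMulLog_mul, Finset.sum_add_distrib, ← Finset.sum_mul, ← Finset.mul_sum, hsum,
    one_mul]

lemma isHermitian_ptraceR_outer {A B : Type*} [Fintype A] [Fintype B] (φ : A × B → ℂ) :
    (ptraceR (outer φ)).IsHermitian := by
  ext a a'
  simp [ptraceR, outer, mul_comm]

lemma IsUnitVec.sum_mul_star {n : Type*} [Fintype n] {φ : n → ℂ} (hφ : IsUnitVec φ) :
    ∑ x, φ x * star (φ x) = 1 := by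
  simp only [Complex.star_def, Complex.mul_conj]
  exact_mod_cast hφ

lemma trace_ptraceR_outer {A B : Type*} [Fintype A] [Fintype B] {φ : A × B → ℂ}
    (hφ : IsUnitVec φ) : (ptraceR (outer φ)).trace = 1 := by
  rw [← hφ.sum_mul_star, Fintype.sum_prod_type]
  simp [ptraceR, outer, Matrix.trace]

section Pure

variable {A B C D : Type*} [Fintype A] [Fintype B] [Fintype C] [Fintype D]
  [DecidableEq A] [DecidableEq B] [DecidableEq C] [DecidableEq D]

lemma entropy_r4BC_outer (Ψ : A × B × D × C → ℂ) :
    entropy (r4BC (outer Ψ)) = entropy (r4AD (outer Ψ)) := by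
  let M : Matrix (B × C) (A × D) ℂ := of fun x y => Ψ (y.1, x.1, y.2, x.2)
  have h₁ : r4BC (outer Ψ) = M * Mᴴ := by
    ext x y
    simp [M, r4BC, outer, Matrix.mul_apply, Fintype.sum_prod_type]
  have h₂ : r4AD (outer Ψ) = (Mᴴ * M)ᵀ := by
    ext x y
    simp [M, r4AD, outer, Matrix.mul_apply, Fintype.sum_prod_type, mul_comm]
  rw [h₁, h₂, entropy_mul_conjTranspose_comm,
    entropy_transpose (isHermitian_conjTranspose_mul_self M)]

lemma entropy_r4ABC_outer (Ψ : A × B × D × C → ℂ) :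
    entropy (r4ABC (outer Ψ)) = entropy (r4D (outer Ψ)) := by
  let M : Matrix (A × B × C) D ℂ := of fun x y => Ψ (x.1, x.2.1, y, x.2.2)
  have h₁ : r4ABC (outer Ψ) = M * Mᴴ := by
    ext x y
    simp [M, r4ABC, outer, Matrix.mul_apply]
  have h₂ : r4D (outer Ψ) = (Mᴴ * M)ᵀ := by
    ext x y
    simp [M, r4D, outer, Matrix.mul_apply, Fintype.sum_prod_type, mul_comm]
  rw [h₁, h₂, entropy_mul_conjTranspose_comm,
    entropy_transpose (isHermitian_conjTranspose_mul_self M)]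

end Pure

end QP

/-- for the pure state `Σᵢ √pᵢ |ψⁱ⟩_{AB}|i⟩_{A'}|i⟩_C` with mutually
orthogonal `|ψⁱ⟩`, one has `(1/2) I(A:B|C) = Σᵢ pᵢ S(ρ_Aⁱ)`. -/
theorem cmi_of_flagged_purification
    {A B I : Type*} [Fintype A] [Fintype B] [Fintype I]
    [DecidableEq A] [DecidableEq B] [DecidableEq I]
    (p : I → ℝ) (hp0 : ∀ i, 0 ≤ p i) (hp1 : ∑ i, p i = 1)
    (ψi : I → (A × B → ℂ)) (hψi : ∀ i, IsUnitVec (ψi i))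
    (horth : ∀ i j, i ≠ j → ∑ z, star (ψi i z) * ψi j z = 0)
    (Ψ : A × B × I × I → ℂ)
    (hΨ : ∀ a b i j, Ψ (a, b, i, j) =
      if i = j then (Real.sqrt (p i) : ℂ) * ψi i (a, b) else 0) :
    cmi4 (outer Ψ) / 2 = ∑ i, p i * entropy (ptraceR (outer (ψi i))) := by
  have hsq : ∀ i, (Real.sqrt (p i) : ℂ) * Real.sqrt (p i) = p i := fun i => by
    rw [← Complex.ofReal_mul, Real.mul_self_sqrt (hp0 i)]
  have hAD : r4AD (outer Ψ) =
      Matrix.blockDiagonal fun i => (p i : ℂ) • ptraceR (outer (ψi i)) := by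
    ext ⟨a, i⟩ ⟨a', j⟩
    by_cases hij : i = j
    · subst hij
      simp only [r4AD, outer, ptraceR, hΨ, Matrix.blockDiagonal_apply, Finset.mul_sum, ← hsq i,
        Matrix.of_apply, Matrix.smul_apply, smul_eq_mul, Complex.star_def, apply_ite, map_mul,
        map_zero, Complex.conj_ofReal, ite_mul, zero_mul, mul_zero, Finset.sum_ite_eq,
        Finset.mem_univ, if_true]
      refine Finset.sum_congr rfl fun b _ => by ring
    · simp [r4AD, outer, hΨ, Matrix.blockDiagonal_apply, hij, Ne.symm hij]
  have hAC : r4AC (outer Ψ) = r4AD (outer Ψ) := by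
    ext ⟨a, i⟩ ⟨a', j⟩
    by_cases hij : i = j <;> simp [r4AC, r4AD, outer, hΨ, hij, eq_comm (a := j)]
  have hD : r4D (outer Ψ) = Matrix.diagonal fun i => (p i : ℂ) := by
    ext i j
    by_cases hij : i = j
    · subst hij
      have h := congrArg ((p i : ℂ) * ·) (hψi i).sum_mul_star
      simp only [Fintype.sum_prod_type, Finset.mul_sum, mul_one, ← hsq i] at h
      simp [r4D, outer, hΨ, ← hsq i]
      rw [← h]
      refine Finset.sum_congr rfl fun a _ => Finset.sum_congr rfl fun b _ => ?_
      simp only [Complex.star_def]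
      ring
    · simp [r4D, outer, hΨ, hij, eq_comm (a := j)]
  have hC : r4C (outer Ψ) = r4D (outer Ψ) := by
    ext i j
    by_cases hij : i = j <;> simp [r4C, r4D, outer, hΨ, hij, eq_comm (a := j)]
  rw [cmi4, entropy_r4BC_outer, entropy_r4ABC_outer, hAC, hC, hAD, hD, entropy_diagonal,
    entropy_blockDiagonal_smul _ _ (fun i => isHermitian_ptraceR_outer _)
      (fun i => trace_ptraceR_outer (hψi i))]
  ring
end
end

section
/- The squashed entanglement is superadditive across tensor products: for any state ρ_{A₁A₂B₁B₂} with marginals ρ_{A₁B₁} and ρ_{A₂B₂}, one has E_sq(A₁A₂ : B₁B₂)(ρ) ≥ E_sq(A₁:B₁)(ρ_{A₁B₁}) + E_sq(A₂:B₂)(ρ_{A₂B₂}). -/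
open scoped BigOperators ComplexOrder

noncomputable section

namespace QP

open Matrix Filter Topology

lemma hasDerivAt_sum_mul_log {ι : Type*} [Fintype ι] (c p q : ι → ℝ) (hp : ∀ i, 0 ≤ p i)
    (hq : ∀ i, 0 < q i) {t : ℝ} (ht : 0 ≤ t) :
    HasDerivAt (fun T => ∑ i, c i * (p i * (Real.log (q i + T * p i) - Real.log (q i))))
      (∑ i, c i * (p i ^ 2 / (q i + t * p i))) t := by
  refine HasDerivAt.fun_sum fun i _ => ?_
  have hpos : q i + t * p i ≠ 0 := (add_pos_of_pos_of_nonneg (hq i) (mul_nonneg ht (hp i))).ne'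
  have h1 : HasDerivAt (fun T => q i + T * p i) (p i) t := by
    simpa using ((hasDerivAt_id t).mul_const (p i)).const_add (q i)
  have h2 := (((h1.log hpos).sub_const (Real.log (q i))).const_mul (p i)).const_mul (c i)
  rwa [← mul_div_assoc, ← sq] at h2

lemma tendsto_sum_mul_log_atTop {ι : Type*} [Fintype ι] (c p q : ι → ℝ) (hp : ∀ i, 0 ≤ p i)
    (hq : ∀ i, 0 < q i) :
    Tendsto (fun T => (∑ i, c i * (p i * (Real.log (q i + T * p i) - Real.log (q i))))
      - (∑ i, c i * p i) * Real.log T) atTop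
      (𝓝 (∑ i, c i * (p i * (Real.log (p i) - Real.log (q i))))) := by
  have h1 : Tendsto (fun T : ℝ => ∑ i, c i * (p i *
      (Real.log (q i * T⁻¹ + p i) - Real.log (q i)))) atTop
      (𝓝 (∑ i, c i * (p i * (Real.log (p i) - Real.log (q i))))) := by
    refine tendsto_finsetSum _ fun i _ => ?_
    rcases (hp i).eq_or_lt with h0 | h0
    · simp [← h0]
    · have h2 : Tendsto (fun T : ℝ => q i * T⁻¹ + p i) atTop (𝓝 (p i)) := by
        simpa using (tendsto_inv_atTop_zero.const_mul (q i)).add_const (p i)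
      exact (((h2.log h0.ne').sub_const _).const_mul _).const_mul _
  refine h1.congr' ?_
  filter_upwards [eventually_gt_atTop 0] with T hT
  rw [Finset.sum_mul, ← Finset.sum_sub_distrib]
  refine Finset.sum_congr rfl fun i _ => ?_
  have hpos : q i + T * p i ≠ 0 :=
    (add_pos_of_pos_of_nonneg (hq i) (mul_nonneg hT.le (hp i))).ne'
  have : q i * T⁻¹ + p i = (q i + T * p i) / T := by field_simp
  rw [this, Real.log_div hpos hT.ne']
  ring

/-- If `∑ c p² / (q + t p)` dominates pointwise in `t ≥ 0`, then so does `∑ c p log (p / q)`. -/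
lemma sum_mul_log_le_of_sum_div_le {ι κ : Type*} [Fintype ι] [Fintype κ]
    (c p q : ι → ℝ) (c' p' q' : κ → ℝ)
    (hp : ∀ i, 0 ≤ p i) (hq : ∀ i, 0 < q i) (hp' : ∀ i, 0 ≤ p' i) (hq' : ∀ i, 0 < q' i)
    (hsum : ∑ i, c' i * p' i = ∑ i, c i * p i)
    (h : ∀ t : ℝ, 0 ≤ t →
      ∑ i, c' i * (p' i ^ 2 / (q' i + t * p' i)) ≤ ∑ i, c i * (p i ^ 2 / (q i + t * p i))) :
    ∑ i, c' i * (p' i * (Real.log (p' i) - Real.log (q' i))) ≤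
      ∑ i, c i * (p i * (Real.log (p i) - Real.log (q i))) := by
  have mono : MonotoneOn (fun T =>
      (∑ i, c i * (p i * (Real.log (q i + T * p i) - Real.log (q i)))) -
      (∑ i, c' i * (p' i * (Real.log (q' i + T * p' i) - Real.log (q' i))))) (Set.Ici 0) := by
    have hd := fun t (ht : (0 : ℝ) ≤ t) =>
      (hasDerivAt_sum_mul_log c p q hp hq ht).fun_sub (hasDerivAt_sum_mul_log c' p' q' hp' hq' ht)
    refine monotoneOn_of_deriv_nonneg (convex_Ici 0)
      (fun t ht => (hd t ht).continuousAt.continuousWithinAt) ?_ ?_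
    · intro t ht
      rw [interior_Ici] at ht
      exact (hd t (le_of_lt ht)).differentiableAt.differentiableWithinAt
    · intro t ht
      rw [interior_Ici] at ht
      rw [(hd t (le_of_lt ht)).deriv]
      exact sub_nonneg.2 (h t (le_of_lt ht))
  refine le_of_tendsto_of_tendsto (tendsto_sum_mul_log_atTop c' p' q' hp' hq')
    (tendsto_sum_mul_log_atTop c p q hp hq) ?_
  filter_upwards [eventually_ge_atTop 0] with T hT
  have := mono (Set.mem_Ici.2 le_rfl) (Set.mem_Ici.2 hT) hT
  simp only [zero_mul, add_zero, sub_self, mul_zero, Finset.sum_const_zero] at this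
  rw [hsum]
  linarith

/-- `ρ = U diag(p) U*` with `U` unitary. -/
structure IsEigenDecomp {n ι : Type*} [Fintype n] [Fintype ι] [DecidableEq n] [DecidableEq ι]
    (ρ : Matrix n n ℂ) (U : Matrix n ι ℂ) (p : ι → ℝ) : Prop where
  star_mul : Uᴴ * U = 1
  mul_star : U * Uᴴ = 1
  eq : ρ = U * diagonal (fun i => (p i : ℂ)) * Uᴴ

section EigenDecomp

variable {n m ι κ : Type*} [Fintype n] [Fintype m] [Fintype ι] [Fintype κ]
  [DecidableEq n] [DecidableEq m] [DecidableEq ι] [DecidableEq κ]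

lemma IsEigenDecomp.of_isHermitian {ρ : Matrix n n ℂ} (h : ρ.IsHermitian) :
    IsEigenDecomp ρ (h.eigenvectorUnitary : Matrix n n ℂ) h.eigenvalues where
  star_mul := Unitary.coe_star_mul_self h.eigenvectorUnitary
  mul_star := Unitary.coe_mul_star_self h.eigenvectorUnitary
  eq := by
    conv_lhs => rw [h.spectral_theorem, Unitary.conjStarAlgAut_apply]
    rfl

lemma entropy_eq_of_isHermitian {ρ : Matrix n n ℂ} (h : ρ.IsHermitian) :
    entropy ρ = -∑ i, h.eigenvalues i * Real.log (h.eigenvalues i) := by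
  rw [entropy, dif_pos h]

lemma IsEigenDecomp.submatrix {ρ : Matrix n n ℂ} {U : Matrix n ι ℂ} {p : ι → ℝ}
    (h : IsEigenDecomp ρ U p) (e : m ≃ n) :
    IsEigenDecomp (ρ.submatrix e e) (U.submatrix e id) p where
  star_mul := by
    rw [conjTranspose_submatrix, submatrix_mul_equiv, h.star_mul, submatrix_id_id]
  mul_star := by
    rw [conjTranspose_submatrix, ← submatrix_mul _ _ _ _ _ Function.bijective_id, h.mul_star,
      submatrix_one_equiv]
  eq := by
    have := h.eq
    ext x y
    simp [this, Matrix.mul_apply]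

lemma IsEigenDecomp.one_kronecker {ρ : Matrix n n ℂ} {U : Matrix n ι ℂ} {p : ι → ℝ}
    (h : IsEigenDecomp ρ U p) :
    IsEigenDecomp (kroneckerMap (· * ·) (1 : Matrix m m ℂ) ρ)
      (kroneckerMap (· * ·) (1 : Matrix m m ℂ) U) (fun x => p x.2) where
  star_mul := by
    rw [conjTranspose_kronecker, ← mul_kronecker_mul, h.star_mul]; simp
  mul_star := by
    rw [conjTranspose_kronecker, ← mul_kronecker_mul, h.mul_star]; simp
  eq := by
    have hd : (diagonal fun x : m × ι => ((p x.2 : ℝ) : ℂ)) =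
        kroneckerMap (· * ·) (1 : Matrix m m ℂ) (diagonal fun i => (p i : ℂ)) := by
      rw [← diagonal_one, diagonal_kronecker_diagonal]; simp
    rw [hd, conjTranspose_kronecker, ← mul_kronecker_mul, ← mul_kronecker_mul, ← h.eq]; simp

lemma IsEigenDecomp.add_smul_one {ρ : Matrix n n ℂ} {U : Matrix n ι ℂ} {p : ι → ℝ}
    (h : IsEigenDecomp ρ U p) (ε : ℝ) :
    IsEigenDecomp (ρ + (ε : ℂ) • 1) U (fun i => p i + ε) where
  star_mul := h.star_mul
  mul_star := h.mul_star
  eq := by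
    have hd : (diagonal fun i => ((p i + ε : ℝ) : ℂ)) =
        diagonal (fun i => (p i : ℂ)) + (ε : ℂ) • 1 := by
      ext i j
      by_cases hij : i = j <;> simp [hij]
    rw [hd, Matrix.mul_add, Matrix.add_mul, ← h.eq]
    simp [h.mul_star]

/-- The concave quadratic functional whose supremum over `X` is
`Tr ρ (L_σ + t R_ρ)⁻¹ ρ`. -/
def variational (t : ℝ) (ρ σ X : Matrix n n ℂ) : ℝ :=
  2 * (Xᴴ * ρ).trace.re - (Xᴴ * σ * X).trace.re - t * (Xᴴ * X * ρ).trace.re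

lemma variational_eq_sum {ρ σ : Matrix n n ℂ} {U : Matrix n ι ℂ} {V : Matrix n κ ℂ}
    {p : ι → ℝ} {q : κ → ℝ} (hρ : IsEigenDecomp ρ U p) (hσ : IsEigenDecomp σ V q)
    (t : ℝ) (Y : Matrix κ ι ℂ) :
    variational t ρ σ (V * Y * Uᴴ) = ∑ x : κ × ι,
      (2 * p x.2 * (star (Y x.1 x.2) * (Vᴴ * U) x.1 x.2).re
        - Complex.normSq (Y x.1 x.2) * (q x.1 + t * p x.2)) := by
  have hXH : (V * Y * Uᴴ)ᴴ = U * Yᴴ * Vᴴ := by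
    simp [conjTranspose_mul, Matrix.mul_assoc]
  have cycl : ∀ M : Matrix ι ι ℂ, (U * M * Uᴴ).trace = M.trace := fun M => by
    rw [trace_mul_comm, ← Matrix.mul_assoc, hρ.star_mul, Matrix.one_mul]
  have e1 : (V * Y * Uᴴ)ᴴ * ρ = U * (Yᴴ * (Vᴴ * U) * diagonal fun i => (p i : ℂ)) * Uᴴ := by
    rw [hXH, hρ.eq]; simp only [Matrix.mul_assoc]
  have e2 : (V * Y * Uᴴ)ᴴ * σ * (V * Y * Uᴴ) =
      U * (Yᴴ * ((diagonal fun i => (q i : ℂ)) * Y)) * Uᴴ := by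
    rw [hXH, hσ.eq]
    calc _ = U * (Yᴴ * (Vᴴ * V) * (diagonal fun i => (q i : ℂ)) * (Vᴴ * V) * Y) * Uᴴ := by
          simp only [Matrix.mul_assoc]
      _ = _ := by rw [hσ.star_mul]; simp only [Matrix.mul_assoc, Matrix.mul_one]
  have e3 : (V * Y * Uᴴ)ᴴ * (V * Y * Uᴴ) * ρ =
      U * (Yᴴ * (Y * diagonal fun i => (p i : ℂ))) * Uᴴ := by
    rw [hXH, hρ.eq]
    calc _ = U * (Yᴴ * (Vᴴ * V) * Y * (Uᴴ * U) * (diagonal fun i => (p i : ℂ))) * Uᴴ := by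
          simp only [Matrix.mul_assoc]
      _ = _ := by
        rw [hσ.star_mul, hρ.star_mul]; simp only [Matrix.mul_assoc, Matrix.mul_one]
  rw [variational, e1, e2, e3, cycl, cycl, cycl]
  simp only [trace, diag_apply, Matrix.mul_diagonal, Matrix.diagonal_mul,
    Matrix.mul_apply (M := Yᴴ), conjTranspose_apply, Complex.re_sum, Finset.sum_mul,
    Finset.mul_sum, ← Finset.sum_sub_distrib]
  rw [Finset.sum_comm, Fintype.sum_prod_type]
  refine Finset.sum_congr rfl fun j _ => Finset.sum_congr rfl fun i _ => ?_
  simp [Complex.normSq_apply]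
  ring

/-- The supremum of the variational functional, in terms of eigendecompositions. -/
lemma variational_le {ρ σ : Matrix n n ℂ} {U : Matrix n ι ℂ} {V : Matrix n κ ℂ}
    {p : ι → ℝ} {q : κ → ℝ} (hρ : IsEigenDecomp ρ U p) (hσ : IsEigenDecomp σ V q)
    (hp : ∀ i, 0 ≤ p i) (hq : ∀ j, 0 < q j) {t : ℝ} (ht : 0 ≤ t) (X : Matrix n n ℂ) :
    variational t ρ σ X ≤ ∑ x : κ × ι,
      Complex.normSq ((Vᴴ * U) x.1 x.2) * (p x.2 ^ 2 / (q x.1 + t * p x.2)) := by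
  have hX : X = V * (Vᴴ * X * U) * Uᴴ := by
    calc X = (V * Vᴴ) * X * (U * Uᴴ) := by rw [hσ.mul_star, hρ.mul_star]; simp
      _ = _ := by simp only [Matrix.mul_assoc]
  rw [hX, variational_eq_sum hρ hσ]
  refine Finset.sum_le_sum fun x _ => ?_
  generalize (Vᴴ * X * U) x.1 x.2 = y
  generalize (Vᴴ * U) x.1 x.2 = w
  have hs : 0 < q x.1 + t * p x.2 := add_pos_of_pos_of_nonneg (hq _) (mul_nonneg ht (hp _))
  generalize q x.1 + t * p x.2 = s at hs
  generalize p x.2 = r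
  rw [← mul_div_assoc, le_div_iff₀ hs]
  simp [Complex.normSq_apply]
  nlinarith [sq_nonneg (s * y.re - r * w.re), sq_nonneg (s * y.im - r * w.im)]

lemma exists_variational_eq {ρ σ : Matrix n n ℂ} {U : Matrix n ι ℂ} {V : Matrix n κ ℂ}
    {p : ι → ℝ} {q : κ → ℝ} (hρ : IsEigenDecomp ρ U p) (hσ : IsEigenDecomp σ V q)
    (hp : ∀ i, 0 ≤ p i) (hq : ∀ j, 0 < q j) {t : ℝ} (ht : 0 ≤ t) :
    ∃ X, variational t ρ σ X = ∑ x : κ × ι,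
      Complex.normSq ((Vᴴ * U) x.1 x.2) * (p x.2 ^ 2 / (q x.1 + t * p x.2)) := by
  refine ⟨V * (Matrix.of fun j i => ((p i / (q j + t * p i) : ℝ) : ℂ) * (Vᴴ * U) j i) * Uᴴ, ?_⟩
  rw [variational_eq_sum hρ hσ]
  refine Finset.sum_congr rfl fun x _ => ?_
  simp only [Matrix.of_apply]
  generalize (Vᴴ * U) x.1 x.2 = w
  have hs : 0 < q x.1 + t * p x.2 := add_pos_of_pos_of_nonneg (hq _) (mul_nonneg ht (hp _))
  generalize q x.1 + t * p x.2 = s at hs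
  generalize p x.2 = r
  generalize hu : r / s = u
  have : r = u * s := by rw [← hu]; field_simp
  subst this
  rw [show (u * s) ^ 2 / s = u ^ 2 * s by field_simp]
  simp only [star_mul', Complex.star_def, Complex.conj_ofReal, Complex.normSq_mul,
    Complex.normSq_ofReal, mul_assoc, Complex.re_ofReal_mul, ← Complex.normSq_eq_conj_mul_self,
    Complex.ofReal_re]
  ring

lemma IsEigenDecomp.sum_normSq_mul {ρ : Matrix n n ℂ} {U : Matrix n ι ℂ} {V : Matrix n κ ℂ}
    {p : ι → ℝ} (hρ : IsEigenDecomp ρ U p) (j : κ) :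
    ∑ i, Complex.normSq ((Vᴴ * U) j i) * p i = ((Vᴴ * ρ * V) j j).re := by
  have : Vᴴ * ρ * V = (Vᴴ * U) * (diagonal (fun i => (p i : ℂ)) * (Vᴴ * U)ᴴ) := by
    rw [hρ.eq]; simp [Matrix.mul_assoc]
  rw [this, Matrix.mul_apply, Complex.re_sum]
  refine Finset.sum_congr rfl fun i _ => ?_
  rw [Matrix.diagonal_mul, conjTranspose_apply]
  simp [Complex.normSq_apply]
  ring

lemma sum_normSq_eq_one {U : Matrix n ι ℂ} {V : Matrix n κ ℂ}
    (hU : Uᴴ * U = 1) (hV : V * Vᴴ = 1) (i : ι) :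
    ∑ j, Complex.normSq ((Vᴴ * U) j i) = 1 := by
  have : (Vᴴ * U)ᴴ * (Vᴴ * U) = 1 := by
    calc _ = Uᴴ * (V * Vᴴ) * U := by simp [conjTranspose_mul, Matrix.mul_assoc]
      _ = 1 := by rw [hV, Matrix.mul_one, hU]
  have h := congrArg Complex.re (congrFun (congrFun this i) i)
  rw [Matrix.mul_apply, Complex.re_sum] at h
  rw [one_apply_eq, Complex.one_re] at h
  rw [← h]
  refine Finset.sum_congr rfl fun j _ => ?_
  simp [conjTranspose_apply, Complex.normSq_apply]

lemma sum_normSq_mul_log {ρ : Matrix n n ℂ} {U : Matrix n ι ℂ} {V : Matrix n κ ℂ}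
    {p : ι → ℝ} (hρ : IsEigenDecomp ρ U p) (hV : V * Vᴴ = 1) (l : κ → ℝ) :
    ∑ x : κ × ι, Complex.normSq ((Vᴴ * U) x.1 x.2) * (p x.2 * (Real.log (p x.2) - l x.1)) =
      ∑ i, p i * Real.log (p i) - ∑ j, ((Vᴴ * ρ * V) j j).re * l j := by
  simp only [mul_sub, Finset.sum_sub_distrib]
  congr 1
  · rw [Fintype.sum_prod_type_right]
    simp only [← Finset.sum_mul, sum_normSq_eq_one hρ.star_mul hV, one_mul]
  · rw [Fintype.sum_prod_type]
    simp only [← hρ.sum_normSq_mul, Finset.sum_mul, mul_assoc]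

lemma IsEigenDecomp.trace_re {ρ : Matrix n n ℂ} {U : Matrix n ι ℂ} {p : ι → ℝ}
    (h : IsEigenDecomp ρ U p) : ρ.trace.re = ∑ i, p i := by
  rw [h.eq, trace_mul_comm, ← Matrix.mul_assoc, h.star_mul, Matrix.one_mul, trace_diagonal]
  simp

end EigenDecomp

section Monotonicity

variable {A B : Type*} [Fintype A] [Fintype B] [DecidableEq A] [DecidableEq B]

lemma trace_kronecker_one_mul (X : Matrix A A ℂ) (ρ : Matrix (A × B) (A × B) ℂ) :
    (kroneckerMap (· * ·) X (1 : Matrix B B ℂ) * ρ).trace = (X * ptraceR ρ).trace := by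
  simp only [trace, diag_apply, Matrix.mul_apply, Fintype.sum_prod_type, kroneckerMap_apply,
    Matrix.one_apply, ptraceR, Matrix.of_apply, Finset.mul_sum]
  refine Finset.sum_congr rfl fun a _ => ?_
  rw [Finset.sum_comm]
  simp [mul_ite, ite_mul]

lemma variational_kronecker_one (t : ℝ) (ρ σ : Matrix (A × B) (A × B) ℂ) (X : Matrix A A ℂ) :
    variational t ρ σ (kroneckerMap (· * ·) X (1 : Matrix B B ℂ)) =
      variational t (ptraceR ρ) (ptraceR σ) X := by
  have hH : (kroneckerMap (· * ·) X (1 : Matrix B B ℂ))ᴴ =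
      kroneckerMap (· * ·) Xᴴ (1 : Matrix B B ℂ) := by
    rw [conjTranspose_kronecker]; simp
  have hmul : ∀ Y Z : Matrix A A ℂ, kroneckerMap (· * ·) Y (1 : Matrix B B ℂ) *
      kroneckerMap (· * ·) Z (1 : Matrix B B ℂ) = kroneckerMap (· * ·) (Y * Z) 1 := fun Y Z => by
    rw [← mul_kronecker_mul, Matrix.mul_one]
  rw [variational, variational, hH, trace_mul_cycle, trace_mul_cycle Xᴴ (ptraceR σ), hmul, hmul,
    trace_kronecker_one_mul, trace_kronecker_one_mul, trace_kronecker_one_mul]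

/-- Monotonicity of the relative entropy under the partial trace. -/
lemma relEntropy_ptraceR_le {ι κ ι' κ' : Type*} [Fintype ι] [Fintype κ] [Fintype ι'] [Fintype κ']
    [DecidableEq ι] [DecidableEq κ] [DecidableEq ι'] [DecidableEq κ']
    {ρ σ : Matrix (A × B) (A × B) ℂ} {U : Matrix (A × B) ι ℂ} {V : Matrix (A × B) κ ℂ}
    {U' : Matrix A ι' ℂ} {V' : Matrix A κ' ℂ}
    {p : ι → ℝ} {q : κ → ℝ} {p' : ι' → ℝ} {q' : κ' → ℝ}
    (hρ : IsEigenDecomp ρ U p) (hσ : IsEigenDecomp σ V q)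
    (hρ' : IsEigenDecomp (ptraceR ρ) U' p') (hσ' : IsEigenDecomp (ptraceR σ) V' q')
    (hp : ∀ i, 0 ≤ p i) (hq : ∀ i, 0 < q i) (hp' : ∀ i, 0 ≤ p' i) (hq' : ∀ i, 0 < q' i) :
    ∑ i, p' i * Real.log (p' i) - ∑ j, ((V'ᴴ * ptraceR ρ * V') j j).re * Real.log (q' j) ≤
      ∑ i, p i * Real.log (p i) - ∑ j, ((Vᴴ * ρ * V) j j).re * Real.log (q j) := by
  rw [← sum_normSq_mul_log hρ hσ.mul_star, ← sum_normSq_mul_log hρ' hσ'.mul_star]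
  refine sum_mul_log_le_of_sum_div_le
    (fun x : κ × ι => Complex.normSq ((Vᴴ * U) x.1 x.2)) (fun x => p x.2) (fun x => q x.1)
    (fun x : κ' × ι' => Complex.normSq ((V'ᴴ * U') x.1 x.2)) (fun x => p' x.2) (fun x => q' x.1)
    (fun x => hp _) (fun x => hq _) (fun x => hp' _) (fun x => hq' _) ?_ fun t ht => ?_
  · rw [Fintype.sum_prod_type_right, Fintype.sum_prod_type_right]
    simp only [← Finset.sum_mul, sum_normSq_eq_one hρ.star_mul hσ.mul_star,
      sum_normSq_eq_one hρ'.star_mul hσ'.mul_star, one_mul]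
    rw [← hρ.trace_re, ← hρ'.trace_re]
    simp [trace, ptraceR, Fintype.sum_prod_type]
  · obtain ⟨X, hX⟩ := exists_variational_eq hρ' hσ' hp' hq' ht
    rw [← hX, ← variational_kronecker_one]
    exact variational_le hρ hσ hp hq ht _

end Monotonicity

section StrongSubadditivity

variable {A B C : Type*} [Fintype A] [Fintype B] [Fintype C]
  [DecidableEq A] [DecidableEq B] [DecidableEq C]

lemma sum_conj_one_kronecker {κ : Type*} [Fintype κ] [DecidableEq κ]
    {ρ : Matrix (A × B) (A × B) ℂ} {V : Matrix B κ ℂ} {r : κ → ℝ}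
    (h : IsEigenDecomp (ptraceL ρ) V r) (f : κ → ℝ) :
    ∑ x : A × κ, (((kroneckerMap (· * ·) (1 : Matrix A A ℂ) V)ᴴ * ρ *
      kroneckerMap (· * ·) (1 : Matrix A A ℂ) V) x x).re * f x.2 = ∑ k, r k * f k := by
  rw [Fintype.sum_prod_type_right]
  refine Finset.sum_congr rfl fun k _ => ?_
  dsimp only
  rw [← Finset.sum_mul, ← Complex.re_sum]
  have h1 : (Vᴴ * ptraceL ρ * V) k k = (r k : ℂ) := by
    have : Vᴴ * ptraceL ρ * V = diagonal fun i => (r i : ℂ) := by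
      rw [h.eq]
      calc _ = (Vᴴ * V) * (diagonal fun i => (r i : ℂ)) * (Vᴴ * V) := by
            simp only [Matrix.mul_assoc]
        _ = _ := by rw [h.star_mul]; simp
    rw [this, diagonal_apply_eq]
  have h2 : ∑ a : A, ((kroneckerMap (· * ·) (1 : Matrix A A ℂ) V)ᴴ * ρ *
      kroneckerMap (· * ·) (1 : Matrix A A ℂ) V) (a, k) (a, k) = (Vᴴ * ptraceL ρ * V) k k := by
    simp only [Matrix.mul_apply, Fintype.sum_prod_type, kroneckerMap_apply, conjTranspose_apply,
      Matrix.one_apply, ptraceL, Matrix.of_apply, Finset.sum_mul, Finset.mul_sum, ite_mul, one_mul,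
      zero_mul, mul_ite, mul_zero, apply_ite (star : ℂ → ℂ), star_zero]
    simp only [Finset.sum_ite_irrel, Finset.sum_const_zero, Finset.sum_ite_eq',
      Finset.mem_univ, if_true]
    rw [Finset.sum_comm]
    refine Finset.sum_congr rfl fun b _ => ?_
    rw [Finset.sum_comm]
  rw [h2, h1, Complex.ofReal_re]

lemma tendsto_sum_mul_log_add {κ : Type*} [Fintype κ] (r : κ → ℝ) (d : ℝ) :
    Tendsto (fun ε => ∑ k, r k * Real.log (r k + ε * d)) (𝓝[>] 0)
      (𝓝 (∑ k, r k * Real.log (r k))) := by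
  refine tendsto_finsetSum _ fun k _ => ?_
  by_cases h0 : r k = 0
  · simp [h0]
  · have h1 : Tendsto (fun ε : ℝ => r k + ε * d) (𝓝[>] 0) (𝓝 (r k)) := by
      have : Tendsto (fun ε : ℝ => r k + ε * d) (𝓝 0) (𝓝 (r k + 0 * d)) :=
        (by fun_prop : Continuous fun ε : ℝ => r k + ε * d).tendsto 0
      rw [zero_mul, add_zero] at this
      exact this.mono_left nhdsWithin_le_nhds
    exact (h1.log h0).const_mul _

lemma PosSemidef.redAC {ρ : Matrix (A × B × C) (A × B × C) ℂ} (h : ρ.PosSemidef) :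
    (redAC ρ).PosSemidef := by
  have : QP.redAC ρ = ∑ b, ρ.submatrix (fun x => (x.1, b, x.2)) (fun x => (x.1, b, x.2)) := by
    ext x y
    simp [QP.redAC, Matrix.sum_apply]
  rw [this]
  exact posSemidef_sum _ fun b _ => h.submatrix _

lemma PosSemidef.ptraceL {ρ : Matrix (A × B) (A × B) ℂ} (h : ρ.PosSemidef) :
    (ptraceL ρ).PosSemidef := by
  have : QP.ptraceL ρ = ∑ a, ρ.submatrix (fun x => (a, x)) (fun x => (a, x)) := by
    ext x y
    simp [QP.ptraceL, Matrix.sum_apply]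
  rw [this]
  exact posSemidef_sum _ fun b _ => h.submatrix _

/-- Strong subadditivity of the von Neumann entropy. -/
theorem cmi_nonneg [Nonempty B] {ρ : Matrix (A × B × C) (A × B × C) ℂ} (h : ρ.PosSemidef) :
    0 ≤ cmi ρ := by
  have hAC := PosSemidef.redAC h
  have hBC : (redBC ρ).PosSemidef := PosSemidef.ptraceL h
  have hC : (redC ρ).PosSemidef := PosSemidef.ptraceL hAC
  let e : (A × C) × B ≃ A × B × C :=
    { toFun := fun x => (x.1.1, x.2, x.1.2)
      invFun := fun x => ((x.1, x.2.2), x.2.1)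
      left_inv := fun _ => rfl
      right_inv := fun _ => rfl }
  have dρ := (IsEigenDecomp.of_isHermitian h.1).submatrix e
  have dAC : IsEigenDecomp (ptraceR (ρ.submatrix e e)) _ _ := IsEigenDecomp.of_isHermitian hAC.1
  have dBC : IsEigenDecomp (ptraceL ρ) _ _ := IsEigenDecomp.of_isHermitian hBC.1
  have dC : IsEigenDecomp (ptraceL (redAC ρ)) _ _ := IsEigenDecomp.of_isHermitian hC.1
  set r := hBC.1.eigenvalues
  set s := hC.1.eigenvalues
  have hr : ∀ k, 0 ≤ r k := hBC.eigenvalues_nonneg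
  have hs : ∀ k, 0 ≤ s k := hC.eigenvalues_nonneg
  have key : ∀ ε : ℝ, 0 < ε →
      -entropy (redAC ρ) - ∑ k, s k * Real.log (s k + ε * Fintype.card B) ≤
      -entropy ρ - ∑ k, r k * Real.log (r k + ε * 1) := by
    intro ε hε
    have dσ := ((dBC.one_kronecker (m := A)).add_smul_one (ε * 1)).submatrix e
    have dσ' := (dC.one_kronecker (m := A)).add_smul_one (ε * Fintype.card B)
    have hσ : ptraceR ((kroneckerMap (· * ·) (1 : Matrix A A ℂ) (ptraceL ρ) +
        ((ε * 1 : ℝ) : ℂ) • 1).submatrix e e) =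
        kroneckerMap (· * ·) (1 : Matrix A A ℂ) (ptraceL (redAC ρ)) +
          ((ε * Fintype.card B : ℝ) : ℂ) • 1 := by
      ext ⟨a, c⟩ ⟨a', c'⟩
      by_cases ha : a = a'
      · subst ha
        by_cases hc : c = c'
        · subst hc
          simp [ptraceR, ptraceL, redAC, e, Finset.sum_add_distrib]
          rw [Finset.sum_comm, mul_comm]
        · simp [ptraceR, ptraceL, redAC, e, Matrix.one_apply, hc]
          rw [Finset.sum_comm]
      · simp [ptraceR, ptraceL, redAC, e, Matrix.one_apply, ha]
    rw [← hσ] at dσ'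
    have hB : (0 : ℝ) < Fintype.card B := by exact_mod_cast Fintype.card_pos
    have main := relEntropy_ptraceR_le dρ dσ dAC dσ' h.eigenvalues_nonneg
      (fun x => add_pos_of_nonneg_of_pos (hr x.2) (by simpa using hε)) hAC.eigenvalues_nonneg
      (fun x => add_pos_of_nonneg_of_pos (hs x.2) (mul_pos hε hB))
    have t1 := sum_conj_one_kronecker dBC (fun k => Real.log (r k + ε * 1))
    have t2 := sum_conj_one_kronecker dC (fun k => Real.log (s k + ε * Fintype.card B))
    rw [conjTranspose_submatrix, submatrix_mul_equiv, submatrix_mul_equiv, submatrix_id_id,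
      t1] at main
    rw [entropy_eq_of_isHermitian h.1, entropy_eq_of_isHermitian hAC.1, neg_neg, neg_neg, ← t2]
    exact main
  have lim := le_of_tendsto_of_tendsto
    ((tendsto_sum_mul_log_add s (Fintype.card B)).const_sub (-entropy (redAC ρ)))
    ((tendsto_sum_mul_log_add r 1).const_sub (-entropy ρ))
    (by filter_upwards [self_mem_nhdsWithin] with ε hε using key ε hε)
  rw [cmi, entropy_eq_of_isHermitian hBC.1, entropy_eq_of_isHermitian hC.1]
  linarith

end StrongSubadditivity

lemma entropy_submatrix {n m : Type*} [Fintype n] [Fintype m] [DecidableEq n] [DecidableEq m]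
    {ρ : Matrix n n ℂ} (h : ρ.IsHermitian) (e : m ≃ n) :
    entropy (ρ.submatrix e e) = entropy ρ := by
  have h' : (ρ.submatrix e e).IsHermitian := h.submatrix e
  have hc : (ρ.submatrix e e).charpoly = ρ.charpoly := charpoly_reindex e.symm ρ
  have hm := congrArg (fun s : Multiset ℂ =>
    (s.map fun z => z.re * Real.log z.re).sum) (congrArg Polynomial.roots hc)
  simp only [h'.roots_charpoly_eq_eigenvalues, h.roots_charpoly_eq_eigenvalues,
    Multiset.map_map] at hm
  rw [entropy_eq_of_isHermitian h, entropy_eq_of_isHermitian h', neg_inj]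
  exact hm

lemma entropy_congr {n m : Type*} [Fintype n] [Fintype m] [DecidableEq n] [DecidableEq m]
    {ρ : Matrix n n ℂ} {τ : Matrix m m ℂ} (h : ρ.IsHermitian) (e : m ≃ n)
    (hτ : ∀ x y, τ x y = ρ (e x) (e y)) : entropy τ = entropy ρ := by
  rw [← entropy_submatrix h e]
  exact congrArg entropy (Matrix.ext hτ)

lemma IsState.nonempty {n : Type*} [Fintype n] {ρ : Matrix n n ℂ} (h : IsState ρ) :
    Nonempty n := by
  by_contra hn
  rw [not_nonempty_iff] at hn
  simpa [trace] using h.2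

lemma IsState.submatrix {n m : Type*} [Fintype n] [Fintype m] {ρ : Matrix n n ℂ}
    (h : IsState ρ) (e : m ≃ n) : IsState (ρ.submatrix e e) :=
  ⟨h.1.submatrix e, by rw [← h.2]; exact e.sum_comp fun i => ρ i i⟩

lemma IsState.redAC {A B C : Type*} [Fintype A] [Fintype B] [Fintype C]
    [DecidableEq A] [DecidableEq B] [DecidableEq C]
    {ρ : Matrix (A × B × C) (A × B × C) ℂ} (h : IsState ρ) : IsState (redAC ρ) := by
  refine ⟨PosSemidef.redAC h.1, ?_⟩
  rw [← h.2]
  simp only [trace, diag_apply, QP.redAC, Matrix.of_apply, Fintype.sum_prod_type]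
  exact Finset.sum_congr rfl fun a _ => Finset.sum_comm

section SquashedEntanglement

variable {A B : Type*} [Fintype A] [Fintype B] [DecidableEq A] [DecidableEq B]

lemma Esq_le_cmi {E : Type*} [Fintype E] [DecidableEq E]
    {ρ : Matrix (A × B) (A × B) ℂ} {σ : Matrix (A × B × E) (A × B × E) ℂ}
    (hσ : IsState σ) (hρ : redAB σ = ρ) : Esq ρ ≤ cmi σ / 2 := by
  refine csInf_le ⟨0, ?_⟩ ?_
  · rintro x ⟨n, τ, hτ, -, rfl⟩
    have : Nonempty B := hτ.nonempty.map fun x => x.2.1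
    have := cmi_nonneg hτ.1
    positivity
  · let f := (Fintype.equivFin E).symm
    let e : A × B × Fin (Fintype.card E) ≃ A × B × E :=
      (Equiv.refl A).prodCongr ((Equiv.refl B).prodCongr f)
    refine ⟨_, σ.submatrix e e, hσ.submatrix e, ?_, ?_⟩
    · rw [← hρ]
      ext x y
      exact f.sum_comp fun c => σ (x.1, x.2, c) (y.1, y.2, c)
    · have hAC := PosSemidef.redAC hσ.1
      have hBC : (redBC σ).PosSemidef := PosSemidef.ptraceL hσ.1
      have hC : (redC σ).PosSemidef := PosSemidef.ptraceL hAC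
      have e1 := entropy_submatrix hσ.1.1 e
      have e2 := entropy_submatrix hAC.1 ((Equiv.refl A).prodCongr f)
      have e3 := entropy_submatrix hBC.1 ((Equiv.refl B).prodCongr f)
      have e4 := entropy_submatrix hC.1 f
      rw [cmi, cmi, ← e1, ← e2, ← e3, ← e4]
      rfl

lemma le_Esq {ρ : Matrix (A × B) (A × B) ℂ} (hρ : IsState ρ) {x : ℝ}
    (h : ∀ (n : ℕ) (σ : Matrix (A × B × Fin n) (A × B × Fin n) ℂ),
      IsState σ → redAB σ = ρ → x ≤ cmi σ / 2) : x ≤ Esq ρ := by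
  refine le_csInf ?_ ?_
  · let e : A × B × Fin 1 ≃ A × B :=
      (Equiv.prodAssoc A B (Fin 1)).symm.trans (Equiv.prodUnique (A × B) (Fin 1))
    refine ⟨_, 1, ρ.submatrix e e, hρ.submatrix e, ?_, rfl⟩
    ext x y
    simp [redAB, e]
  · rintro y ⟨n, σ, hσ, hσρ, rfl⟩
    exact h n σ hσ hσρ

end SquashedEntanglement

/-- The conditional mutual information dominates `I(A₁:B₁|E) + I(A₂:B₂|A₁B₁E)`. -/
lemma exists_cmi_add_cmi_le {A₁ A₂ B₁ B₂ E : Type*} [Fintype A₁] [Fintype A₂] [Fintype B₁]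
    [Fintype B₂] [Fintype E] [DecidableEq A₁] [DecidableEq A₂] [DecidableEq B₁] [DecidableEq B₂]
    [DecidableEq E]
    {σ : Matrix ((A₁ × A₂) × (B₁ × B₂) × E) ((A₁ × A₂) × (B₁ × B₂) × E) ℂ} (hσ : IsState σ) :
    ∃ (σ₁ : Matrix (A₁ × B₁ × E) (A₁ × B₁ × E) ℂ)
      (σ₂ : Matrix (A₂ × B₂ × A₁ × B₁ × E) (A₂ × B₂ × A₁ × B₁ × E) ℂ),
      IsState σ₁ ∧ IsState σ₂ ∧
      (∀ x y, σ₁ x y = ∑ a₂, ∑ b₂, σ ((x.1, a₂), (x.2.1, b₂), x.2.2)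
        ((y.1, a₂), (y.2.1, b₂), y.2.2)) ∧
      (∀ x y, σ₂ x y = σ ((x.2.2.1, x.1), (x.2.2.2.1, x.2.1), x.2.2.2.2)
        ((y.2.2.1, y.1), (y.2.2.2.1, y.2.1), y.2.2.2.2)) ∧
      cmi σ₁ + cmi σ₂ ≤ cmi σ := by
  let e₂ : A₂ × B₂ × A₁ × B₁ × E ≃ (A₁ × A₂) × (B₁ × B₂) × E :=
    { toFun := fun x => ((x.2.2.1, x.1), (x.2.2.2.1, x.2.1), x.2.2.2.2)
      invFun := fun x => (x.1.2, x.2.1.2, x.1.1, x.2.1.1, x.2.2)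
      left_inv := fun _ => rfl
      right_inv := fun _ => rfl }
  let eA : A₂ × B₁ × A₁ × E ≃ A₂ × A₁ × B₁ × E :=
    { toFun := fun x => (x.1, x.2.2.1, x.2.1, x.2.2.2)
      invFun := fun x => (x.1, x.2.2.1, x.2.1, x.2.2.2)
      left_inv := fun _ => rfl
      right_inv := fun _ => rfl }
  let σ₂ := σ.submatrix e₂ e₂
  have hσ₂ : IsState σ₂ := hσ.submatrix e₂
  have hA : (redAC σ₂).PosSemidef := PosSemidef.redAC hσ₂.1
  have hB : (redBC σ₂).PosSemidef := PosSemidef.ptraceL hσ₂.1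
  have hσ₁ : (redC σ₂).PosSemidef := PosSemidef.ptraceL hA
  have : Nonempty B₁ := hσ.nonempty.map fun x => x.2.1.1
  have : Nonempty A₁ := hσ.nonempty.map fun x => x.1.1
  have ssaA := cmi_nonneg (hA.submatrix eA)
  have ssaB := cmi_nonneg (hB)
  have hAC := PosSemidef.redAC hσ.1
  have hBC : (redBC σ).PosSemidef := PosSemidef.ptraceL hσ.1
  have σ₁_apply : ∀ x y, redC σ₂ x y = ∑ a₂, ∑ b₂, σ ((x.1, a₂), (x.2.1, b₂), x.2.2)
      ((y.1, a₂), (y.2.1, b₂), y.2.2) := fun _ _ => rfl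
  have hσ₁' : IsState (redC σ₂) := ⟨hσ₁, by
    rw [← (IsState.redAC hσ₂).2]
    simp only [trace, diag_apply, Fintype.sum_prod_type (α₁ := A₂)]
    exact Finset.sum_comm⟩
  refine ⟨redC σ₂, σ₂, hσ₁', hσ₂, σ₁_apply, fun _ _ => rfl, ?_⟩
  have s1 : entropy σ₂ = entropy σ := entropy_submatrix hσ.1.1 e₂
  have s2 : entropy (redAC ((redAC σ₂).submatrix eA eA)) = entropy (redAC σ) := by
    refine entropy_congr hAC.1 ((Equiv.prodAssoc A₂ A₁ E).symm.trans
      ((Equiv.prodComm A₂ A₁).prodCongr (Equiv.refl E))) fun x y => ?_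
    simp [redAC, Fintype.sum_prod_type, σ₂, e₂, eA]
  have s3 : entropy (redAC (redBC σ₂)) = entropy (redBC σ) := by
    refine entropy_congr hBC.1 ((Equiv.prodAssoc B₂ B₁ E).symm.trans
      ((Equiv.prodComm B₂ B₁).prodCongr (Equiv.refl E))) fun x y => ?_
    simp [redAC, redBC, Fintype.sum_prod_type, σ₂, e₂]
  have s4 : entropy (redBC ((redAC σ₂).submatrix eA eA)) = entropy (redC σ₂) := by
    refine entropy_congr hσ₁.1 ((Equiv.prodAssoc B₁ A₁ E).symm.trans
      (((Equiv.prodComm B₁ A₁).prodCongr (Equiv.refl E)).trans (Equiv.prodAssoc A₁ B₁ E)))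
      fun x y => ?_
    simp [redAC, redBC, redC, eA]
  have s5 : entropy ((redAC σ₂).submatrix eA eA) = entropy (redAC σ₂) :=
    entropy_submatrix hA.1 eA
  have s6 : redC ((redAC σ₂).submatrix eA eA) = redAC (redC σ₂) := by
    ext x y
    simp only [redAC, redC, Matrix.of_apply, submatrix_apply]
    exact Finset.sum_comm
  have s7 : redC (redBC σ₂) = redBC (redC σ₂) := by
    ext x y
    simp only [redBC, redC, Matrix.of_apply]
    rw [Finset.sum_comm]
    exact Finset.sum_congr rfl fun _ _ => Finset.sum_comm
  have s8 : redBC (redBC σ₂) = redC σ₂ := by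
    ext x y
    simp only [redBC, redC, Matrix.of_apply]
    exact Finset.sum_comm
  have s9 : redC (redC σ₂) = redC σ := by
    ext x y
    simp only [redC, Matrix.of_apply, Fintype.sum_prod_type]
    exact Finset.sum_congr rfl fun _ _ => Finset.sum_comm
  rw [cmi, s2, s4, s5, s6] at ssaA
  rw [cmi, s3, s7, s8] at ssaB
  rw [cmi, cmi, cmi, s1, s9]
  linarith

end QP

open QP

/-- superadditivity of the squashed entanglement. -/
theorem Esq_superadditive
    {A₁ A₂ B₁ B₂ : Type*} [Fintype A₁] [Fintype A₂] [Fintype B₁] [Fintype B₂]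
    [DecidableEq A₁] [DecidableEq A₂] [DecidableEq B₁] [DecidableEq B₂]
    (ρ : Matrix ((A₁ × A₂) × (B₁ × B₂)) ((A₁ × A₂) × (B₁ × B₂)) ℂ) (hρ : IsState ρ)
    (ρ₁ : Matrix (A₁ × B₁) (A₁ × B₁) ℂ)
    (hρ₁ : ∀ x y, ρ₁ x y = ∑ a₂, ∑ b₂, ρ ((x.1, a₂), (x.2, b₂)) ((y.1, a₂), (y.2, b₂)))
    (ρ₂ : Matrix (A₂ × B₂) (A₂ × B₂) ℂ)
    (hρ₂ : ∀ x y, ρ₂ x y = ∑ a₁, ∑ b₁, ρ ((a₁, x.1), (b₁, x.2)) ((a₁, y.1), (b₁, y.2))) :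
    Esq ρ₁ + Esq ρ₂ ≤ Esq ρ := by
  refine le_Esq hρ fun n σ hσ hσρ => ?_
  obtain ⟨σ₁, σ₂, hσ₁, hσ₂, h₁, h₂, hle⟩ := exists_cmi_add_cmi_le hσ
  have b₁ : Esq ρ₁ ≤ cmi σ₁ / 2 := by
    refine Esq_le_cmi hσ₁ ?_
    ext x y
    simp only [hρ₁, ← hσρ, redAB, Matrix.of_apply, h₁]
    rw [Finset.sum_comm]
    exact Finset.sum_congr rfl fun _ _ => Finset.sum_comm
  have b₂ : Esq ρ₂ ≤ cmi σ₂ / 2 := by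
    refine Esq_le_cmi hσ₂ ?_
    ext x y
    simp only [hρ₂, ← hσρ, redAB, Matrix.of_apply, h₂, Fintype.sum_prod_type]
  linarith
end
end
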